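/- arXiv:2409.03467 — 9 statements merged into one kernel-verified Lean document; each statement's English description precedes it below -/
import Mathlib

section
/- Let n and k be positive integers with gcd(k, n) = 1, and let f : F_{2^n} → F_{2^n} be the power function f(x) = x^(2^(2k) + 2^k + 1). Then f has optimal second-order differential uniformity: for all distinct nonzero a, b ∈ F_{2^n} and every c ∈ F_{2^n}, the equation f(x) + f(x+a) + f(x+b) + f(x+a+b) = c has at most 4 solutions x in F_{2^n}. -/
/-- In a field with `2 ^ n` elements, the `k`-th iterate of Frobenius with `k` prime to `n`
fixes only `0` and `1`. -/
theorem eq_zero_or_eq_one_of_iterateFrobenius_eq {F : Type*} [Field F] [Fintype F] [CharP F 2]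
    {n k : ℕ} (hcard : Fintype.card F = 2 ^ n) (hgcd : Nat.gcd k n = 1) {x : F}
    (hx : iterateFrobenius F 2 k x = x) : x = 0 ∨ x = 1 := by
  have hk : Function.IsPeriodicPt (frobenius F 2) k x := by
    rwa [Function.IsPeriodicPt, Function.IsFixedPt, ← coe_iterateFrobenius]
  have hn : Function.IsPeriodicPt (frobenius F 2) n x := by
    rw [Function.IsPeriodicPt, Function.IsFixedPt, iterate_frobenius, ← hcard,
      FiniteField.pow_card]
  have h := hk.gcd hn
  rw [hgcd, Function.IsPeriodicPt, Function.IsFixedPt, iterate_frobenius] at h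
  have h' : x * (x - 1) = 0 := by linear_combination h
  exact (mul_eq_zero.mp h').imp_right sub_eq_zero.mp

/-- If a field endomorphism `σ` in characteristic two fixes only `0` and `1`, then the vanishing of
the Moore determinant of `a`, `b`, `d` forces `d` into the span of `a` and `b` over `𝔽₂`. -/
theorem mem_span_of_moore_det_eq_zero {F : Type*} [Field F] [CharP F 2] (σ : F →+* F)
    (hσ : ∀ x, σ x = x → x = 0 ∨ x = 1) {a b d : F} (ha : a ≠ 0) (hb : b ≠ 0) (hab : a ≠ b)
    (hdet : a * σ b * σ (σ d) + a * σ d * σ (σ b) + b * σ a * σ (σ d) + b * σ d * σ (σ a)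
      + d * σ a * σ (σ b) + d * σ b * σ (σ a) = 0) :
    d = 0 ∨ d = a ∨ d = b ∨ d = a + b := by
  have h2 : (2 : F) = 0 := CharTwo.two_eq_zero
  obtain ⟨u, rfl⟩ : ∃ u, b = a * u := ⟨b / a, by field_simp⟩
  obtain ⟨v, rfl⟩ : ∃ v, d = a * v := ⟨d / a, by field_simp⟩
  have hA : u + σ u ≠ 0 := fun h => by
    rcases hσ u (by linear_combination h - u * h2) with rfl | rfl
    · simp at hb
    · simp at hab
  have hσa : σ a ≠ 0 := (map_ne_zero σ).mpr ha
  have hσσa : σ (σ a) ≠ 0 := (map_ne_zero σ).mpr hσa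
  have hAB : (u + σ u) * σ (v + σ v) + (v + σ v) * σ (u + σ u) = 0 := by
    have : a * σ a * σ (σ a)
        * ((u + σ u) * σ (v + σ v) + (v + σ v) * σ (u + σ u)) = 0 := by
      simp only [map_mul, map_add] at hdet ⊢
      linear_combination hdet + a * σ a * σ (σ a) * (σ u * σ v) * h2
    simpa [ha, hσa, hσσa] using this
  have hratio : σ ((v + σ v) / (u + σ u)) = (v + σ v) / (u + σ u) := by
    rw [map_div₀, div_eq_div_iff ((map_ne_zero σ).mpr hA) hA]
    linear_combination hAB - (v + σ v) * σ (u + σ u) * h2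
  rcases hσ _ hratio with h | h
  · have hv : v + σ v = 0 := by simpa [hA] using h
    rcases hσ v (by linear_combination hv - v * h2) with rfl | rfl <;> simp
  · rw [div_eq_one_iff_eq hA] at h
    rcases hσ (u + v) (by rw [map_add]; linear_combination h + (σ u - v) * h2) with h | h
    · right; right; left
      linear_combination a * h - a * u * h2
    · right; right; right
      linear_combination a * h - a * u * h2

theorem optimal_second_order_differential_uniformity
    (n k : ℕ) (hn : 0 < n) (hk : 0 < k) (hgcd : Nat.gcd k n = 1)
    (F : Type*) [Field F] [Fintype F] [DecidableEq F] [CharP F 2]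
    (hcard : Fintype.card F = 2 ^ n)
    (f : F → F) (hf : ∀ x, f x = x ^ (2 ^ (2 * k) + 2 ^ k + 1)) :
    ∀ a b : F, a ≠ 0 → b ≠ 0 → a ≠ b → ∀ c : F,
      (Finset.univ.filter
        (fun x : F => f x + f (x + a) + f (x + b) + f (x + a + b) = c)).card ≤ 4 := by
  intro a b ha hb hab c
  have hf' : ∀ x, f x = x * iterateFrobenius F 2 k x
      * iterateFrobenius F 2 k (iterateFrobenius F 2 k x) := fun x => by
    rw [hf, iterateFrobenius_def, iterateFrobenius_def, ← pow_mul, ← pow_add, ← two_mul]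
    ring
  have hσ (x : F) : iterateFrobenius F 2 k x = x → x = 0 ∨ x = 1 :=
    eq_zero_or_eq_one_of_iterateFrobenius_eq hcard hgcd
  generalize iterateFrobenius F 2 k = σ at hf' hσ
  obtain hempty | ⟨y, hy⟩ := (Finset.univ.filter
    (fun x : F => f x + f (x + a) + f (x + b) + f (x + a + b) = c)).eq_empty_or_nonempty
  · simp [hempty]
  refine (Finset.card_le_card (t := {y, y + a, y + b, y + (a + b)}) fun x hx => ?_).trans
    Finset.card_le_four
  simp only [Finset.mem_filter, Finset.mem_univ, true_and] at hx hy
  obtain ⟨d, rfl⟩ : ∃ d, x = y + d := ⟨x - y, by ring⟩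
  have key : d = 0 ∨ d = a ∨ d = b ∨ d = a + b := by
    refine mem_span_of_moore_det_eq_zero σ hσ ha hb hab ?_
    have h := hx.trans hy.symm
    simp only [hf', map_add] at h
    have h2 : (2 : F) = 0 := CharTwo.two_eq_zero
    grind
  rcases key with rfl | rfl | rfl | rfl <;> simp
end

section
/- Let n and k be positive integers with gcd(k, n) = 1, let f : F_{2^n} → F_{2^n} be f(x) = x^(2^(2k) + 2^k + 1), and let c ∈ F_{2^n} with c ≠ 0 and c ≠ 1. Then the map x ↦ f(x) + f(x+1) + f(x+c) + f(x+1+c) is exactly 4-to-1: every value attained by this map has exactly 4 preimages in F_{2^n}. -/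
theorem eq_zero_or_eq_one_of_pow_two_pow_eq_self {n k : ℕ} (hgcd : Nat.gcd k n = 1)
    {F : Type*} [Field F] [Fintype F] (hcard : Fintype.card F = 2 ^ n)
    {x : F} (hx : x ^ 2 ^ k = x) : x = 0 ∨ x = 1 := by
  have periodic (m : ℕ) (h : x ^ 2 ^ m = x) :
      Function.IsPeriodicPt (fun y : F => y ^ 2) m x := by
    rw [Function.IsPeriodicPt, Function.IsFixedPt, pow_iterate]
    exact h
  have hn : x ^ 2 ^ n = x := hcard ▸ FiniteField.pow_card x
  have h := (periodic k hx).gcd (periodic n hn)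
  rw [hgcd, Function.IsPeriodicPt, Function.IsFixedPt, Function.iterate_one] at h
  have h0 : x * (x - 1) = 0 := by linear_combination h
  rcases mul_eq_zero.mp h0 with h | h
  · exact Or.inl h
  · exact Or.inr (sub_eq_zero.mp h)

/-- The kernel of the linear part of the second derivative of `x * s x * s (s x)` in the
directions `1` and `c`. -/
theorem linear_part_eq_zero_iff {F : Type*} [Field F] [CharP F 2] (s : F →+* F)
    (hs : ∀ x, s x = x → x = 0 ∨ x = 1) {c : F} (hc0 : c ≠ 0) (hc1 : c ≠ 1) (x : F) :
    (c + s c) * (s (s x) + s x) + (s c + s (s c)) * (s x + x) = 0 ↔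
      x = 0 ∨ x = 1 ∨ x = c ∨ x = c + 1 := by
  have h2 : (2 : F) = 0 := CharTwo.two_eq_zero
  constructor
  · intro h
    have hd : c + s c ≠ 0 := fun h0 =>
      (hs c (by linear_combination h0 - c * h2)).elim hc0 hc1
    have hsd : s c + s (s c) ≠ 0 := by
      rw [← map_add]; exact (map_ne_zero s).mpr hd
    have hu : s ((s x + x) / (c + s c)) = (s x + x) / (c + s c) := by
      rw [map_div₀, map_add, map_add, div_eq_div_iff hsd hd]
      linear_combination h - (s c + s (s c)) * (s x + x) * h2
    rcases hs _ hu with h0 | h1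
    · have h0 := (div_eq_zero_iff.mp h0).resolve_right hd
      rcases hs x (by linear_combination h0 - x * h2) with h | h <;> simp [h]
    · have h1 := (div_eq_one_iff_eq hd).mp h1
      rcases hs (x + c) (by rw [map_add]; linear_combination h1 - (x - s c) * h2) with h | h
      · exact Or.inr (Or.inr (Or.inl (by linear_combination h - c * h2)))
      · exact Or.inr (Or.inr (Or.inr (by linear_combination h - c * h2)))
  · rintro (rfl | rfl | rfl | rfl)
    · simp
    · simp only [map_one]
      linear_combination (c + 2 * s c + s (s c)) * h2
    · linear_combination (x + s x) * (s x + s (s x)) * h2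
    · simp only [map_add, map_one]
      linear_combination ((c + s c) * (s c + s (s c)) + c + 2 * s c + s (s c)) * h2

theorem second_derivative_four_to_one
    (n k : ℕ) (hn : 0 < n) (hk : 0 < k) (hgcd : Nat.gcd k n = 1)
    (F : Type*) [Field F] [Fintype F] [DecidableEq F] [CharP F 2]
    (hcard : Fintype.card F = 2 ^ n)
    (f : F → F) (hf : ∀ x, f x = x ^ (2 ^ (2 * k) + 2 ^ k + 1))
    (c : F) (hc0 : c ≠ 0) (hc1 : c ≠ 1) :
    ∀ y : F,
      (∃ x : F, f x + f (x + 1) + f (x + c) + f (x + 1 + c) = y) →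
      (Finset.univ.filter
        (fun x : F => f x + f (x + 1) + f (x + c) + f (x + 1 + c) = y)).card = 4 := by
  rintro y ⟨x₀, rfl⟩
  let s : F →+* F := iterateFrobenius F 2 k
  have hs (x : F) (hx : s x = x) : x = 0 ∨ x = 1 :=
    eq_zero_or_eq_one_of_pow_two_pow_eq_self hgcd hcard hx
  have hfs (x : F) : f x = x * s x * s (s x) := by
    change f x = x * x ^ 2 ^ k * (x ^ 2 ^ k) ^ 2 ^ k
    rw [hf, ← pow_mul, ← pow_add, two_mul]
    ring
  have h2 : (2 : F) = 0 := CharTwo.two_eq_zero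
  have key (x : F) : f x + f (x + 1) + f (x + c) + f (x + 1 + c) =
      (c + s c) * (s (s x) + s x) + (s c + s (s c)) * (s x + x) +
        (f 1 + f c + f (1 + c)) := by
    simp only [hfs, map_add, map_one]
    ring_nf
    simp only [h2, CharTwo.ofNat_eq_mod]
    ring
  have hset : (Finset.univ.filter fun x : F => f x + f (x + 1) + f (x + c) + f (x + 1 + c) =
      f x₀ + f (x₀ + 1) + f (x₀ + c) + f (x₀ + 1 + c)) =
      ({0, 1, c, c + 1} : Finset F).image (· + x₀) := by
    ext x
    simp only [Finset.mem_filter, Finset.mem_univ, true_and, Finset.mem_image]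
    have hiff := linear_part_eq_zero_iff s hs hc0 hc1 (x - x₀)
    simp only [map_sub] at hiff
    rw [key x, key x₀, ← sub_eq_zero]
    constructor
    · intro h
      refine ⟨x - x₀, ?_, sub_add_cancel x x₀⟩
      simpa using hiff.mp (by linear_combination h)
    · rintro ⟨z, hz, rfl⟩
      have h := hiff.mpr (by simpa using hz)
      linear_combination h
  rw [hset, Finset.card_image_of_injective _ (add_left_injective x₀)]
  have h1 : c ≠ c + 1 := by simp
  have h3 : (0 : F) ≠ c + 1 := fun h => hc1 (by linear_combination -h - h2)
  have h4 : (1 : F) ≠ c + 1 := fun h => hc0 (by linear_combination -h)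
  simp [Finset.card_insert_of_notMem, hc0.symm, hc1.symm, h1, h3, h4]
end

section
/- Let n and k be positive integers with gcd(k, n) > 1, and let f : F_{2^n} → F_{2^n} be the power function f(x) = x^(2^(2k) + 2^k + 1). Then f has maximal second-order differential uniformity 2^n: there exist distinct nonzero a, b ∈ F_{2^n} and c ∈ F_{2^n} such that f(x) + f(x+a) + f(x+b) + f(x+a+b) = c holds for every x ∈ F_{2^n}. -/
/-- If `gcd k n > 1`, then a field with `2 ^ n` elements has an element other than `0` and `1`
that is fixed by the `2 ^ k`-power map. -/
theorem exists_pow_two_pow_eq_self {n k : ℕ} (hgcd : 1 < Nat.gcd k n)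
    {F : Type*} [Field F] [Fintype F] (hcard : Fintype.card F = 2 ^ n) :
    ∃ b : F, b ≠ 0 ∧ b ≠ 1 ∧ b ^ 2 ^ k = b := by
  classical
  have hne : 2 ^ Nat.gcd k n - 1 ≠ 1 := by
    have : 2 ^ 2 ≤ 2 ^ Nat.gcd k n := Nat.pow_le_pow_right (by norm_num) hgcd
    omega
  obtain ⟨p, hp, hpd⟩ := Nat.exists_prime_and_dvd hne
  have : Fact p.Prime := ⟨hp⟩
  have dvd_of : ∀ m, Nat.gcd k n ∣ m → p ∣ 2 ^ m - 1 := fun m hm =>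
    hpd.trans (Nat.pow_sub_one_dvd_pow_sub_one 2 hm)
  have hpF : p ∣ Fintype.card Fˣ := by
    rw [Fintype.card_units, hcard]
    exact dvd_of n (Nat.gcd_dvd_right k n)
  obtain ⟨u, hu⟩ := exists_prime_orderOf_dvd_card p hpF
  refine ⟨u, u.ne_zero, ?_, ?_⟩
  · rw [Ne, Units.val_eq_one]
    rintro rfl
    exact hp.one_lt.ne (by simpa using hu)
  · have h1 : u ^ (2 ^ k - 1) = 1 :=
      orderOf_dvd_iff_pow_eq_one.mp (hu ▸ dvd_of k (Nat.gcd_dvd_left k n))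
    have h2 : u ^ 2 ^ k = u := by
      rw [← Nat.sub_add_cancel (Nat.one_le_two_pow (n := k)), pow_succ, h1, one_mul]
    exact_mod_cast congrArg Units.val h2

theorem maximal_second_order_differential_uniformity
    (n k : ℕ) (hn : 0 < n) (hk : 0 < k) (hgcd : 1 < Nat.gcd k n)
    (F : Type*) [Field F] [Fintype F] [DecidableEq F] [CharP F 2]
    (hcard : Fintype.card F = 2 ^ n)
    (f : F → F) (hf : ∀ x, f x = x ^ (2 ^ (2 * k) + 2 ^ k + 1)) :
    ∃ a b c : F, a ≠ 0 ∧ b ≠ 0 ∧ a ≠ b ∧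
      ∀ x : F, f x + f (x + a) + f (x + b) + f (x + a + b) = c := by
  obtain ⟨b, hb0, hb1, hb⟩ := exists_pow_two_pow_eq_self hgcd hcard
  have hb2 : b ^ 2 ^ (2 * k) = b := by rw [two_mul, pow_add, pow_mul, hb, hb]
  refine ⟨1, b, b + b ^ 2, one_ne_zero, hb0, hb1.symm, fun x => ?_⟩
  have h2 : (2 : F) = 0 := CharTwo.two_eq_zero
  simp only [hf, pow_succ _ (2 ^ (2 * k) + 2 ^ k), pow_add _ (2 ^ (2 * k)) (2 ^ k),
    add_pow_char_pow, one_pow, hb, hb2]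
  generalize x ^ 2 ^ (2 * k) = z
  generalize x ^ 2 ^ k = y
  grind
end

section
/- Let n and k be positive integers with gcd(k, n) = 1, set q = 2^k, and let c ∈ F_{2^n} with c ≠ 0 and c ≠ 1. Then the set of solutions z ∈ F_{2^n} of the equation z^(q²)·(c^q + c) + z^q·(c^(q²) + c) + z·(c^(q²) + c^q) = 0 is exactly {0, 1, c, 1 + c}. -/
theorem eq_zero_or_one_of_pow_two_pow_eq_self {F : Type*} [Field F] [Fintype F] {n k : ℕ}
    (hcard : Fintype.card F = 2 ^ n) (hgcd : Nat.gcd k n = 1) {x : F} (hx : x ^ 2 ^ k = x) :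
    x = 0 ∨ x = 1 := by
  have hk : Function.IsPeriodicPt (fun y : F => y ^ 2) k x := by
    simp only [Function.IsPeriodicPt, Function.IsFixedPt, pow_iterate, hx]
  have hn : Function.IsPeriodicPt (fun y : F => y ^ 2) n x := by
    simp only [Function.IsPeriodicPt, Function.IsFixedPt, pow_iterate, ← hcard,
      FiniteField.pow_card]
  have h := hk.gcd hn
  rw [hgcd] at h
  have h2 : x ^ 2 = x := h
  have h3 : x * (x - 1) = 0 := by linear_combination h2
  exact (mul_eq_zero.mp h3).imp_right sub_eq_zero.mp

theorem solution_set_of_linearized_equation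
    (n k : ℕ) (hn : 0 < n) (hk : 0 < k) (hgcd : Nat.gcd k n = 1)
    (q : ℕ) (hq : q = 2 ^ k)
    (F : Type*) [Field F] [Fintype F] [DecidableEq F] [CharP F 2]
    (hcard : Fintype.card F = 2 ^ n)
    (c : F) (hc0 : c ≠ 0) (hc1 : c ≠ 1) :
    ∀ z : F,
      z ^ (q ^ 2) * (c ^ q + c) + z ^ q * (c ^ (q ^ 2) + c) +
          z * (c ^ (q ^ 2) + c ^ q) = 0 ↔
        z = 0 ∨ z = 1 ∨ z = c ∨ z = 1 + c := by
  intro z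
  have two : (2 : F) = 0 := CharTwo.two_eq_zero
  have fixed : ∀ x : F, x ^ q = x → x = 0 ∨ x = 1 := fun x hx =>
    eq_zero_or_one_of_pow_two_pow_eq_self hcard hgcd (hq ▸ hx)
  have add_pow_q : ∀ x y : F, (x + y) ^ q = x ^ q + y ^ q := fun x y => by
    rw [hq, add_pow_char_pow]
  have pow_q_sq : ∀ x : F, x ^ q ^ 2 = (x ^ q) ^ q := fun x => by rw [sq, pow_mul]
  have hd : c ^ q + c ≠ 0 := fun h =>
    (fixed c (CharTwo.add_eq_zero.mp h)).elim hc0 hc1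
  have hq0 : q ≠ 0 := by simp [hq]
  rw [pow_q_sq, pow_q_sq]
  constructor
  · intro h
    have hcross : (z ^ q + z) ^ q * (c ^ q + c) = (z ^ q + z) * (c ^ q + c) ^ q := by
      rw [add_pow_q, add_pow_q]
      linear_combination h - (z ^ q * (c ^ q) ^ q + z * (c ^ q) ^ q + z * c ^ q) * two
    have hratio : ((z ^ q + z) / (c ^ q + c)) ^ q = (z ^ q + z) / (c ^ q + c) := by
      rw [div_pow, div_eq_div_iff (pow_ne_zero q hd) hd, hcross]
    rcases fixed _ hratio with h0 | h1
    · have hz : z ^ q + z = 0 := (div_eq_zero_iff.mp h0).resolve_right hd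
      exact (fixed z (CharTwo.add_eq_zero.mp hz)).imp_right Or.inl
    · have hz : z ^ q + z = c ^ q + c := (div_eq_one_iff_eq hd).mp h1
      have hzc : (z + c) ^ q = z + c := by
        rw [add_pow_q]
        linear_combination hz + (c ^ q - z) * two
      rcases fixed _ hzc with h0 | h1
      · exact Or.inr (Or.inr (Or.inl (CharTwo.add_eq_zero.mp h0)))
      · exact Or.inr (Or.inr (Or.inr (by linear_combination h1 - c * two)))
  · rintro (rfl | rfl | rfl | rfl)
    · simp [hq0]
    · simp only [one_pow]
      linear_combination (c + c ^ q + (c ^ q) ^ q) * two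
    · linear_combination (z * z ^ q + z * (z ^ q) ^ q + z ^ q * (z ^ q) ^ q) * two
    · simp only [add_pow_q, one_pow]
      linear_combination (c + c ^ q + (c ^ q) ^ q +
        c * c ^ q + c * (c ^ q) ^ q + c ^ q * (c ^ q) ^ q) * two
end

section
/- Let n, k be positive integers, let f : F_{2^n} → F_{2^n} be f(x) = x^(2^(2k) + 2^k + 1), and let c ∈ F_{2^n} satisfy c^(2^k) = c with c ≠ 0 and c ≠ 1. Then the map x ↦ f(x) + f(x+1) + f(x+c) + f(x+1+c) is constant on F_{2^n}, equal to its value at 0. -/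
/-- The value at `x + t` of the cubic power map, for `t` fixed by the `2 ^ k`-power map. -/
theorem cubic_pow_add_of_pow_eq {F : Type*} [Field F] [CharP F 2] {k : ℕ} (x : F) {t : F}
    (ht : t ^ (2 ^ k) = t) :
    (x + t) ^ (2 ^ (2 * k) + 2 ^ k + 1) =
      (x ^ (2 ^ (2 * k)) + t) * (x ^ (2 ^ k) + t) * (x + t) := by
  have ht2 : t ^ (2 ^ (2 * k)) = t := by
    rw [two_mul, pow_add, pow_mul, ht, ht]
  rw [pow_succ, pow_add, add_pow_char_pow, add_pow_char_pow, ht, ht2]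

theorem second_derivative_constant_on_subfield_direction
    (n k : ℕ) (hn : 0 < n) (hk : 0 < k)
    (F : Type*) [Field F] [Fintype F] [DecidableEq F] [CharP F 2]
    (hcard : Fintype.card F = 2 ^ n)
    (f : F → F) (hf : ∀ x, f x = x ^ (2 ^ (2 * k) + 2 ^ k + 1))
    (c : F) (hc : c ^ (2 ^ k) = c) (hc0 : c ≠ 0) (hc1 : c ≠ 1) :
    ∀ x : F,
      f x + f (x + 1) + f (x + c) + f (x + 1 + c) =
        f 0 + f (0 + 1) + f (0 + c) + f (0 + 1 + c) := by
  have h1c : (1 + c) ^ (2 ^ k) = 1 + c := by rw [add_pow_char_pow, one_pow, hc]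
  have h2 : (2 : F) = 0 := CharTwo.two_eq_zero
  have key : ∀ x : F, f x + f (x + 1) + f (x + c) + f (x + 1 + c) = 1 + c ^ 3 + (1 + c) ^ 3 := by
    intro x
    rw [add_assoc x 1 c, hf, hf, hf, hf, cubic_pow_add_of_pow_eq x (one_pow _),
      cubic_pow_add_of_pow_eq x hc, cubic_pow_add_of_pow_eq x h1c, pow_succ, pow_add]
    generalize x ^ (2 ^ (2 * k)) = z
    generalize x ^ (2 ^ k) = y
    linear_combination (2 * x * y * z + (x * y + y * z + z * x) * (1 + c)
      + (x + y + z) * (1 + c + c ^ 2)) * h2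
  intro x
  rw [key x, key 0]
end

section
/- Let i, j, n be positive integers with 0 < i < j < n, j ≠ 2i, and n odd, and let f : F_{2^n} → F_{2^n} be the power function f(x) = x^(2^j + 2^i + 1). Suppose f has optimal second-order differential uniformity, i.e., for all distinct nonzero a, b ∈ F_{2^n} and every c ∈ F_{2^n}, the equation f(x) + f(x+a) + f(x+b) + f(x+a+b) = c has at most 4 solutions. Then gcd(i, n) = gcd(j, n) = gcd(j − i, n) = 1. -/
/-- An element fixed by the `d`-th power of Frobenius is fixed by every power of it. -/
theorem pow_two_pow_eq_self_of_dvd {M : Type*} [Monoid M] {d m : ℕ} (hdm : d ∣ m) {x : M}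
    (hx : x ^ 2 ^ d = x) : x ^ 2 ^ m = x := by
  obtain ⟨k, rfl⟩ := hdm
  induction k with
  | zero => simp
  | succ k ih => rw [Nat.mul_succ, pow_add, pow_mul, ih, hx]

/-- If `3 ≤ d ∣ n`, then `F_{2^n}` has at least eight elements fixed by `x ↦ x ^ 2 ^ d`. -/
theorem eight_le_card_fixed {F : Type*} [Field F] [Fintype F] [DecidableEq F] {d n : ℕ}
    (hcard : Fintype.card F = 2 ^ n) (hd : 3 ≤ d) (hdn : d ∣ n) :
    8 ≤ (Finset.univ.filter (fun x : F => x ^ 2 ^ d = x)).card := by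
  obtain ⟨g, hg⟩ := IsCyclic.exists_ofOrder_eq_natCard (α := Fˣ)
  rw [Nat.card_eq_fintype_card, Fintype.card_units, hcard] at hg
  have h8 : 2 ^ 3 ≤ 2 ^ d := Nat.pow_le_pow_right (by norm_num) hd
  have hdvd : 2 ^ d - 1 ∣ 2 ^ n - 1 := Nat.pow_sub_one_dvd_pow_sub_one 2 hdn
  obtain ⟨u, hu⟩ : ∃ u : Fˣ, orderOf u = 2 ^ d - 1 := by
    have hpos : 2 ^ n - 1 ≠ 0 := hg ▸ (orderOf_pos g).ne'
    refine ⟨g ^ ((2 ^ n - 1) / (2 ^ d - 1)), ?_⟩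
    have := orderOf_pow_orderOf_div (x := g) (n := 2 ^ d - 1) (by rw [hg]; exact hpos)
      (by rw [hg]; exact hdvd)
    rwa [hg] at this
  have hfix : (u : F) ^ 2 ^ d = u := by
    have h1 : u ^ (2 ^ d - 1) = 1 := hu ▸ pow_orderOf_eq_one u
    have h2 : u ^ 2 ^ d = u := by
      rw [← Nat.sub_add_cancel (show 1 ≤ 2 ^ d by omega), pow_succ, h1, one_mul]
    exact_mod_cast congrArg Units.val h2
  have hinj : Set.InjOn (fun k : ℕ => (u : F) ^ k) (Finset.range 7) := by
    intro k hk l hl hkl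
    simp only [Finset.coe_range, Set.mem_Iio] at hk hl
    refine pow_injOn_Iio_orderOf (x := u) ?_ ?_ (Units.ext (by simpa using hkl)) <;>
      simp only [Set.mem_Iio] <;> omega
  have hzero : (0 : F) ∉ (Finset.range 7).image (fun k : ℕ => (u : F) ^ k) := by
    simp
  calc 8 = (insert (0 : F) ((Finset.range 7).image (fun k : ℕ => (u : F) ^ k))).card := by
        rw [Finset.card_insert_of_notMem hzero, Finset.card_image_of_injOn hinj,
          Finset.card_range]
    _ ≤ _ := Finset.card_le_card fun x hx => by
        simp only [Finset.mem_insert, Finset.mem_image, Finset.mem_filter, Finset.mem_univ,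
          true_and] at hx ⊢
        rcases hx with rfl | ⟨k, -, rfl⟩
        · simp
        · rw [← pow_mul, mul_comm, pow_mul, hfix]

/-- If two of the maps `x`, `x ^ 2 ^ i`, `x ^ 2 ^ j` agree at `x` and `b`, then the second
derivative of `x ^ (2 ^ j + 2 ^ i + 1)` in directions `1, b` takes the same value at `x` and `0`. -/
theorem second_derivative_eq_of_eq {F : Type*} [Field F] [CharP F 2] {i j : ℕ} {f : F → F}
    (hf : ∀ x, f x = x ^ (2 ^ j + 2 ^ i + 1)) {x b : F}
    (h : (x ^ 2 ^ i = x ∧ b ^ 2 ^ i = b) ∨ (x ^ 2 ^ j = x ∧ b ^ 2 ^ j = b) ∨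
      (x ^ 2 ^ j = x ^ 2 ^ i ∧ b ^ 2 ^ j = b ^ 2 ^ i)) :
    f x + f (x + 1) + f (x + b) + f (x + 1 + b) = f 1 + f b + f (1 + b) := by
  have h2 : (2 : F) = 0 := CharTwo.two_eq_zero
  simp only [hf, pow_add, pow_one, add_pow_char_pow, one_pow]
  generalize x ^ 2 ^ i = X at *
  generalize x ^ 2 ^ j = Y at *
  generalize b ^ 2 ^ i = B at *
  generalize b ^ 2 ^ j = C at *
  rcases h with ⟨rfl, rfl⟩ | ⟨rfl, rfl⟩ | ⟨rfl, rfl⟩ <;> grind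

/-- If `F_{2^n}` has a subfield `F_{2^d}`, `d ≥ 3`, on which two of the maps `x`, `x ^ 2 ^ i`,
`x ^ 2 ^ j` agree, then `x ^ (2 ^ j + 2 ^ i + 1)` is not optimal. -/
theorem exists_four_lt_card_second_derivative {F : Type*} [Field F] [Fintype F] [DecidableEq F]
    [CharP F 2] {i j n d : ℕ} (hcard : Fintype.card F = 2 ^ n) (hd : 3 ≤ d) (hdn : d ∣ n)
    {f : F → F} (hf : ∀ x, f x = x ^ (2 ^ j + 2 ^ i + 1))
    (h : d ∣ i ∨ d ∣ j ∨ (i ≤ j ∧ d ∣ j - i)) :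
    ∃ a b : F, a ≠ 0 ∧ b ≠ 0 ∧ a ≠ b ∧ ∃ c : F, 4 < (Finset.univ.filter
      (fun x : F => f x + f (x + a) + f (x + b) + f (x + a + b) = c)).card := by
  set K := Finset.univ.filter (fun x : F => x ^ 2 ^ d = x) with hK
  have hK8 : 8 ≤ K.card := eight_le_card_fixed hcard hd hdn
  have hmem {x : F} : x ∈ K ↔ x ^ 2 ^ d = x := by simp [hK]
  obtain ⟨b, hbK, hb⟩ : ∃ b ∈ K, b ∉ ({0, 1} : Finset F) :=
    Finset.exists_mem_notMem_of_card_lt_card (Finset.card_le_two.trans_lt (by omega))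
  simp only [Finset.mem_insert, Finset.mem_singleton, not_or] at hb
  refine ⟨1, b, one_ne_zero, hb.1, Ne.symm hb.2, f 1 + f b + f (1 + b),
    lt_of_lt_of_le (by omega) (Finset.card_le_card (s := K) fun x hx => ?_)⟩
  rw [hmem] at hx hbK
  refine Finset.mem_filter.2 ⟨Finset.mem_univ _, second_derivative_eq_of_eq hf ?_⟩
  have key {y : F} (hy : y ^ 2 ^ d = y) (hij : i ≤ j) (hdij : d ∣ j - i) :
      y ^ 2 ^ j = y ^ 2 ^ i := by
    rw [← Nat.sub_add_cancel hij, pow_add, pow_mul, pow_two_pow_eq_self_of_dvd hdij hy]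
  rcases h with h | h | ⟨hij, h⟩
  · exact .inl ⟨pow_two_pow_eq_self_of_dvd h hx, pow_two_pow_eq_self_of_dvd h hbK⟩
  · exact .inr (.inl ⟨pow_two_pow_eq_self_of_dvd h hx, pow_two_pow_eq_self_of_dvd h hbK⟩)
  · exact .inr (.inr ⟨key hx hij h, key hbK hij h⟩)

theorem necessary_condition_odd_case
    (i j n : ℕ) (hi : 0 < i) (hij : i < j) (hjn : j < n)
    (hj2i : j ≠ 2 * i) (hodd : Odd n)
    (F : Type*) [Field F] [Fintype F] [DecidableEq F] [CharP F 2]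
    (hcard : Fintype.card F = 2 ^ n)
    (f : F → F) (hf : ∀ x, f x = x ^ (2 ^ j + 2 ^ i + 1))
    (hopt : ∀ a b : F, a ≠ 0 → b ≠ 0 → a ≠ b → ∀ c : F,
      (Finset.univ.filter
        (fun x : F => f x + f (x + a) + f (x + b) + f (x + a + b) = c)).card ≤ 4) :
    Nat.gcd i n = 1 ∧ Nat.gcd j n = 1 ∧ Nat.gcd (j - i) n = 1 := by
  have key {d : ℕ} (hdn : d ∣ n) (h : d ∣ i ∨ d ∣ j ∨ (i ≤ j ∧ d ∣ j - i)) : d = 1 := by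
    by_contra hd1
    obtain ⟨k, hk⟩ := hodd.of_dvd_nat hdn
    obtain ⟨a, b, ha, hb, hab, c, hc⟩ :=
      exists_four_lt_card_second_derivative hcard (by omega : 3 ≤ d) hdn hf h
    exact hc.not_ge (hopt a b ha hb hab c)
  exact ⟨key (Nat.gcd_dvd_right _ _) (.inl (Nat.gcd_dvd_left _ _)),
    key (Nat.gcd_dvd_right _ _) (.inr (.inl (Nat.gcd_dvd_left _ _))),
    key (Nat.gcd_dvd_right _ _) (.inr (.inr ⟨hij.le, Nat.gcd_dvd_left _ _⟩))⟩
end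

section
/- Let i, j, n be positive integers with 0 < i < j < n, j ≠ 2i, and n even, and let f : F_{2^n} → F_{2^n} be the power function f(x) = x^(2^j + 2^i + 1). Suppose f has optimal second-order differential uniformity, i.e., for all distinct nonzero a, b ∈ F_{2^n} and every c ∈ F_{2^n}, the equation f(x) + f(x+a) + f(x+b) + f(x+a+b) = c has at most 4 solutions. Then exactly one of gcd(i, n), gcd(j, n), gcd(j − i, n) equals 2, and the other two equal 1. -/
/-- A finite set annihilated by the symmetric trilinear form attached to `x ^ (2 ^ j + 2 ^ i + 1)`
in the directions `1, h` lies in a single fibre of the second derivative. -/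
theorem card_le_four_of_trilinear_eq_zero {F : Type*} [Field F] [Fintype F] [DecidableEq F]
    [CharP F 2] {i j : ℕ} {f : F → F} (hf : ∀ x, f x = x ^ (2 ^ j + 2 ^ i + 1))
    (hopt : ∀ a b : F, a ≠ 0 → b ≠ 0 → a ≠ b → ∀ c : F,
      (Finset.univ.filter
        (fun x : F => f x + f (x + a) + f (x + b) + f (x + a + b) = c)).card ≤ 4)
    {h : F} (h0 : h ≠ 0) (h1 : h ≠ 1) (S : Finset F)
    (hS : ∀ x ∈ S, h ^ 2 ^ i * x ^ 2 ^ j + h ^ 2 ^ j * x ^ 2 ^ i + h * x ^ 2 ^ j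
      + h ^ 2 ^ j * x + h * x ^ 2 ^ i + h ^ 2 ^ i * x = 0) : S.card ≤ 4 := by
  refine le_trans (Finset.card_le_card fun x hx => ?_)
    (hopt 1 h one_ne_zero h0 h1.symm (f 1 + f h + f (1 + h)))
  have hT := hS x hx
  have h2 : (2 : F) = 0 := CharTwo.two_eq_zero
  simp only [Finset.mem_filter, Finset.mem_univ, true_and, hf, pow_add, pow_one, one_pow,
    add_pow_char_pow]
  generalize x ^ 2 ^ i = y at *
  generalize x ^ 2 ^ j = z at *
  generalize h ^ 2 ^ i = p at *
  generalize h ^ 2 ^ j = q at *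
  grind

theorem pow_two_pow_eq_self_of_orderOf_eq {M : Type*} [Monoid M] {h : M} {d k : ℕ}
    (hd : orderOf h = 2 ^ d - 1) (hdk : d ∣ k) : h ^ 2 ^ k = h := by
  have hdvd : orderOf h ∣ 2 ^ k - 1 := hd ▸ Nat.pow_sub_one_dvd_pow_sub_one 2 hdk
  rw [← Nat.sub_add_cancel (Nat.one_le_two_pow (n := k)), pow_succ,
    orderOf_dvd_iff_pow_eq_one.mp hdvd, one_mul]

theorem exists_orderOf_eq_two_pow_sub_one {F : Type*} [Field F] [Fintype F] {d n : ℕ}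
    (hcard : Fintype.card F = 2 ^ n) (hn : 0 < n) (hdn : d ∣ n) :
    ∃ h : F, h ≠ 0 ∧ orderOf h = 2 ^ d - 1 := by
  classical
  obtain ⟨g, hg⟩ := IsCyclic.exists_ofOrder_eq_natCard (α := Fˣ)
  rw [Nat.card_eq_fintype_card, Fintype.card_units, hcard] at hg
  obtain ⟨k, hk⟩ := Nat.pow_sub_one_dvd_pow_sub_one 2 hdn
  have hpos : 0 < 2 ^ n - 1 := Nat.sub_pos_of_lt (Nat.one_lt_two_pow hn.ne')
  have hk0 : k ≠ 0 := by
    rintro rfl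
    omega
  refine ⟨(g ^ k : Fˣ), Units.ne_zero _, ?_⟩
  rw [orderOf_units, orderOf_pow_of_dvd hk0 (hg ▸ hk ▸ Dvd.intro_left _ rfl), hg, hk,
    Nat.mul_div_cancel _ (Nat.pos_of_ne_zero hk0)]

/-- If `h` generates the multiplicative group of a subfield of order `2 ^ d` on which two of the
maps `x`, `x ^ 2 ^ i`, `x ^ 2 ^ j` agree, then `d ≤ 2`. -/
theorem le_two_of_dvd_exponent {F : Type*} [Field F] [Fintype F] [DecidableEq F]
    [CharP F 2] {i j n d : ℕ} (hij : i < j) (hn : 0 < n) (hcard : Fintype.card F = 2 ^ n)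
    {f : F → F} (hf : ∀ x, f x = x ^ (2 ^ j + 2 ^ i + 1))
    (hopt : ∀ a b : F, a ≠ 0 → b ≠ 0 → a ≠ b → ∀ c : F,
      (Finset.univ.filter
        (fun x : F => f x + f (x + a) + f (x + b) + f (x + a + b) = c)).card ≤ 4)
    (hdn : d ∣ n) (hd : d ∣ i ∨ d ∣ j ∨ d ∣ j - i) : d ≤ 2 := by
  by_contra! hlt
  obtain ⟨h, h0, hord⟩ := exists_orderOf_eq_two_pow_sub_one hcard hn hdn
  have h7 : 7 ≤ orderOf h := by
    have := Nat.pow_le_pow_right (n := 2) two_pos hlt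
    omega
  have hne (k : ℕ) (hk : k ≠ 0) (hk3 : k < 7) : h ^ k ≠ 1 :=
    pow_ne_one_of_lt_orderOf hk (hk3.trans_le h7)
  have h1 : h ≠ 1 := by simpa using hne 1 one_ne_zero (by norm_num)
  have h2 := hne 2 two_ne_zero (by norm_num)
  have h3 := hne 3 three_ne_zero (by norm_num)
  have two : (2 : F) = 0 := CharTwo.two_eq_zero
  have hpow : h ^ 2 ^ i = h ∨ h ^ 2 ^ j = h ∨ h ^ 2 ^ j = h ^ 2 ^ i := by
    refine hd.imp (pow_two_pow_eq_self_of_orderOf_eq hord)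
      (Or.imp (pow_two_pow_eq_self_of_orderOf_eq hord) fun hd => ?_)
    rw [← Nat.sub_add_cancel hij.le, pow_add, pow_mul,
      pow_two_pow_eq_self_of_orderOf_eq hord hd]
  have hcard5 : ({0, 1, h, 1 + h, h ^ 2} : Finset F).card = 5 := by
    rw [Finset.card_eq_succ]
    refine ⟨0, {1, h, 1 + h, h ^ 2}, by grind, rfl, ?_⟩
    rw [Finset.card_eq_succ]
    refine ⟨1, {h, 1 + h, h ^ 2}, by grind, rfl, ?_⟩
    rw [Finset.card_eq_three]
    exact ⟨h, 1 + h, h ^ 2, by grind, by grind, by grind, rfl⟩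
  have := card_le_four_of_trilinear_eq_zero hf hopt h0 h1 {0, 1, h, 1 + h, h ^ 2} (by
    intro x hx
    simp only [Finset.mem_insert, Finset.mem_singleton] at hx
    rcases hx with hx | hx | hx | hx | hx <;>
      simp only [hx, add_pow_char_pow, one_pow, pow_right_comm h 2, ne_eq, Nat.pow_eq_zero,
        OfNat.ofNat_ne_zero, false_and, not_false_eq_true, zero_pow] <;>
      generalize h ^ 2 ^ i = p at * <;>
      generalize h ^ 2 ^ j = q at * <;>
      grind)
  omega

theorem not_two_dvd_exponents {F : Type*} [Field F] [Fintype F] [DecidableEq F]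
    [CharP F 2] {i j n : ℕ} (hn : 2 < n) (heven : 2 ∣ n) (hcard : Fintype.card F = 2 ^ n)
    {f : F → F} (hf : ∀ x, f x = x ^ (2 ^ j + 2 ^ i + 1))
    (hopt : ∀ a b : F, a ≠ 0 → b ≠ 0 → a ≠ b → ∀ c : F,
      (Finset.univ.filter
        (fun x : F => f x + f (x + a) + f (x + b) + f (x + a + b) = c)).card ≤ 4)
    (hi : 2 ∣ i) (hj : 2 ∣ j) : False := by
  obtain ⟨h, h0, hord⟩ := exists_orderOf_eq_two_pow_sub_one hcard (by omega) heven
  have h1 : h ≠ 1 := by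
    rintro rfl
    norm_num at hord
  have two : (2 : F) = 0 := CharTwo.two_eq_zero
  have := card_le_four_of_trilinear_eq_zero hf hopt h0 h1 Finset.univ (by
    intro x _
    rw [pow_two_pow_eq_self_of_orderOf_eq hord hi, pow_two_pow_eq_self_of_orderOf_eq hord hj]
    grind)
  rw [Finset.card_univ, hcard] at this
  have := Nat.pow_le_pow_right (n := 2) two_pos hn
  omega


theorem necessary_condition_even_case
    (i j n : ℕ) (hi : 0 < i) (hij : i < j) (hjn : j < n)
    (hj2i : j ≠ 2 * i) (heven : Even n)
    (F : Type*) [Field F] [Fintype F] [DecidableEq F] [CharP F 2]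
    (hcard : Fintype.card F = 2 ^ n)
    (f : F → F) (hf : ∀ x, f x = x ^ (2 ^ j + 2 ^ i + 1))
    (hopt : ∀ a b : F, a ≠ 0 → b ≠ 0 → a ≠ b → ∀ c : F,
      (Finset.univ.filter
        (fun x : F => f x + f (x + a) + f (x + b) + f (x + a + b) = c)).card ≤ 4) :
    (Nat.gcd i n = 2 ∧ Nat.gcd j n = 1 ∧ Nat.gcd (j - i) n = 1) ∨
    (Nat.gcd i n = 1 ∧ Nat.gcd j n = 2 ∧ Nat.gcd (j - i) n = 1) ∨
    (Nat.gcd i n = 1 ∧ Nat.gcd j n = 1 ∧ Nat.gcd (j - i) n = 2) := by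
  have hn : 0 < n := by omega
  have h2n : 2 ∣ n := heven.two_dvd
  have hle {d : ℕ} := le_two_of_dvd_exponent (d := d) hij hn hcard hf hopt
  have hi2 := hle (Nat.gcd_dvd_right i n) (.inl (Nat.gcd_dvd_left i n))
  have hj2 := hle (Nat.gcd_dvd_right j n) (.inr (.inl (Nat.gcd_dvd_left j n)))
  have hd2 := hle (Nat.gcd_dvd_right (j - i) n) (.inr (.inr (Nat.gcd_dvd_left (j - i) n)))
  have hnot : ¬(2 ∣ i ∧ 2 ∣ j) := fun h =>
    not_two_dvd_exponents (by omega) h2n hcard hf hopt h.1 h.2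
  have hgcd (k : ℕ) (hk : Nat.gcd k n ≤ 2) :
      2 ∣ k ∧ Nat.gcd k n = 2 ∨ ¬ 2 ∣ k ∧ Nat.gcd k n = 1 := by
    have hpos := Nat.gcd_pos_of_pos_right k hn
    have hiff : 2 ∣ Nat.gcd k n ↔ 2 ∣ k := by simp [Nat.dvd_gcd_iff, h2n]
    omega
  have := hgcd i hi2
  have := hgcd j hj2
  have := hgcd (j - i) hd2
  omega
end

section
/- Let i, j, n be positive integers with 0 < i < j < n and 2j ≡ i (mod n), and set k = j − i. Then for every x ∈ F_{2^n}, (x^(2^j + 2^i + 1))^(2^(2k)) = x^(2^(2k) + 2^k + 1). In particular, the power function x ↦ x^(2^j + 2^i + 1) is affine equivalent (via composition with the linear bijection y ↦ y^(2^(2k))) to x ↦ x^(2^(2k) + 2^k + 1). -/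
theorem add_eq_of_two_mul_modEq {i j n : ℕ} (hi : 0 < i) (hij : i < j) (hjn : j < n)
    (hmod : 2 * j ≡ i [MOD n]) : 2 * j = i + n := by
  obtain ⟨c, hc⟩ := (Nat.modEq_iff_dvd' (by omega)).mp hmod.symm
  have hc0 : 0 < c := Nat.pos_of_ne_zero (by rintro rfl; omega)
  have hc2 : c < 2 := by
    by_contra! h
    have := Nat.mul_le_mul_left n h
    omega
  obtain rfl : c = 1 := by omega
  omega

theorem affine_equivalence_two_j_equiv_i
    (i j n : ℕ) (hi : 0 < i) (hij : i < j) (hjn : j < n)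
    (hmod : 2 * j ≡ i [MOD n])
    (k : ℕ) (hk : k = j - i)
    (F : Type*) [Field F] [Fintype F] [DecidableEq F] [CharP F 2]
    (hcard : Fintype.card F = 2 ^ n) :
    (∀ x : F, (x ^ (2 ^ j + 2 ^ i + 1)) ^ (2 ^ (2 * k)) =
        x ^ (2 ^ (2 * k) + 2 ^ k + 1)) ∧
      Function.Bijective (fun y : F => y ^ (2 ^ (2 * k))) := by
  have hn := add_eq_of_two_mul_modEq hi hij hjn hmod
  refine ⟨fun x => ?_, Finite.injective_iff_bijective.mp (iterateFrobenius_inj F 2 (2 * k))⟩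
  have hx : x ^ 2 ^ n = x := hcard ▸ FiniteField.pow_card x
  have hexp : (2 ^ j + 2 ^ i + 1) * 2 ^ (2 * k) = 2 ^ n * 2 ^ k + 2 ^ n + 2 ^ (2 * k) := by
    rw [add_mul, add_mul, one_mul, ← pow_add, ← pow_add, ← pow_add,
      show j + 2 * k = n + k by omega, show i + 2 * k = n by omega]
  rw [← pow_mul, hexp, pow_add, pow_add, pow_mul, hx]
  ring
end

section
/- Let i, j, n be positive integers with 0 < i < j < n, and let f : F_{2^n} → F_{2^n} be the power function f(x) = x^(2^j + 2^i + 1). Suppose one of the following holds: (1) j ≡ 2i (mod n) and gcd(i, n) = 1; (2) 2j ≡ i (mod n) and gcd(j − i, n) = 1; (3) j ≡ −i (mod n) and gcd(i, n) = 1. Then f has optimal second-order differential uniformity: for all distinct nonzero a, b ∈ F_{2^n} and every c ∈ F_{2^n}, the equation f(x) + f(x+a) + f(x+b) + f(x+a+b) = c has at most 4 solutions x in F_{2^n}. -/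
/-- The symmetric trilinear form attached to the cubic map `x ↦ x * σ x * σ (σ x)`. In
characteristic two it is the Moore determinant of the three vectors. -/
def mooreForm {F : Type*} [Field F] (σ : F →+* F) (a b z : F) : F :=
  a * (σ b * σ (σ z) + σ z * σ (σ b)) + b * (σ a * σ (σ z) + σ z * σ (σ a)) +
    z * (σ a * σ (σ b) + σ b * σ (σ a))

/-- The difference of two values of a second-order derivative of `x ↦ x * σ x * σ (σ x)` is a value
of the Moore form. -/
theorem mooreForm_eq_zero_of_secondDeriv_eq {F : Type*} [Field F] [CharP F 2] (σ : F →+* F)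
    (g : F → F) (hg : ∀ x, g x = x * σ x * σ (σ x)) {a b x y : F}
    (h : g x + g (x + a) + g (x + b) + g (x + a + b) =
      g y + g (y + a) + g (y + b) + g (y + a + b)) :
    mooreForm σ a b (x - y) = 0 := by
  have h' : g x - g (x + a) - g (x + b) + g (x + a + b) =
      g y - g (y + a) - g (y + b) + g (y + a + b) := by
    simpa only [CharTwo.sub_eq_add] using h
  simp only [hg, map_add] at h'
  simp only [mooreForm, map_sub]
  linear_combination h'

/-- If `σ` fixes only `0` and `1`, the Moore form vanishes only on linearly dependent triples. -/
theorem mem_span_of_mooreForm_eq_zero {F : Type*} [Field F] [CharP F 2] (σ : F →+* F)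
    (hσ : ∀ y, σ y = y → y = 0 ∨ y = 1) {a b z : F} (ha : a ≠ 0) (hb : b ≠ 0) (hab : a ≠ b)
    (h : mooreForm σ a b z = 0) : z = 0 ∨ z = a ∨ z = b ∨ z = a + b := by
  have two : (2 : F) = 0 := CharTwo.two_eq_zero
  obtain ⟨u, rfl⟩ : ∃ u, b = a * u := ⟨b / a, by field_simp⟩
  obtain ⟨v, rfl⟩ : ∃ v, z = a * v := ⟨z / a, by field_simp⟩
  have hu : u - σ u ≠ 0 := by
    intro hu
    rcases hσ u (sub_eq_zero.mp hu).symm with rfl | rfl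
    · exact hb (mul_zero a)
    · exact hab (mul_one a).symm
  have hsu : σ u - σ (σ u) ≠ 0 := by
    rw [← map_sub]
    exact (map_ne_zero σ).mpr hu
  have hprod : a * σ a * σ (σ a) *
      ((v - σ v) * (σ u - σ (σ u)) - (σ v - σ (σ v)) * (u - σ u)) = 0 := by
    simp only [mooreForm, map_mul] at h
    linear_combination h - a * σ a * σ (σ a) *
      (v * σ (σ u) + σ v * u + σ u * σ (σ v)) * two
  have ha' : a * σ a * σ (σ a) ≠ 0 := by simp [ha]
  have hquot := (mul_eq_zero.mp hprod).resolve_left ha'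
  have hfix : σ ((v - σ v) / (u - σ u)) = (v - σ v) / (u - σ u) := by
    rw [map_div₀, map_sub, map_sub, div_eq_div_iff hsu hu]
    linear_combination -hquot
  rcases hσ _ hfix with hv | hv
  · have hv' : σ v = v := by
      rw [div_eq_zero_iff, or_iff_left hu] at hv
      exact (sub_eq_zero.mp hv).symm
    rcases hσ v hv' with rfl | rfl <;> simp
  · rw [div_eq_one_iff_eq hu] at hv
    have hvu : σ (v - u) = v - u := by
      rw [map_sub]
      linear_combination -hv
    rcases hσ _ hvu with h0 | h1
    · rw [sub_eq_zero.mp h0]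
      simp
    · rw [sub_eq_iff_eq_add.mp h1]
      right; right; right
      ring

theorem card_secondDeriv_fiber_le_four {F : Type*} [Field F] [Fintype F] [DecidableEq F]
    [CharP F 2] (σ ρ : F →+* F) (hσ : ∀ y, σ y = y → y = 0 ∨ y = 1)
    (f : F → F) (hf : ∀ x, ρ (f x) = x * σ x * σ (σ x))
    {a b : F} (ha : a ≠ 0) (hb : b ≠ 0) (hab : a ≠ b) (c : F) :
    (Finset.univ.filter
      (fun x : F => f x + f (x + a) + f (x + b) + f (x + a + b) = c)).card ≤ 4 := by
  rcases Finset.eq_empty_or_nonempty (Finset.univ.filter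
    (fun x : F => f x + f (x + a) + f (x + b) + f (x + a + b) = c)) with hS | ⟨y, hy⟩
  · simp [hS]
  · refine (Finset.card_le_card (t := {y, a + y, b + y, a + b + y}) ?_).trans
      Finset.card_le_four
    intro x hx
    rw [Finset.mem_filter] at hx hy
    have h := congrArg ρ (hx.2.trans hy.2.symm)
    simp only [map_add] at h
    have := mem_span_of_mooreForm_eq_zero σ hσ ha hb hab
      (mooreForm_eq_zero_of_secondDeriv_eq σ (fun x => ρ (f x)) hf h)
    simpa only [Finset.mem_insert, Finset.mem_singleton, sub_eq_iff_eq_add, zero_add] using this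

theorem isPeriodicPt_sq_iff {M : Type*} [Monoid M] (k : ℕ) (x : M) :
    Function.IsPeriodicPt (fun y : M => y ^ 2) k x ↔ x ^ 2 ^ k = x := by
  rw [Function.IsPeriodicPt, Function.IsFixedPt, pow_iterate]

theorem pow_two_pow_eq_of_modEq {M : Type*} [Monoid M] {n k l : ℕ} {x : M}
    (hx : x ^ 2 ^ n = x) (h : k ≡ l [MOD n]) : x ^ 2 ^ k = x ^ 2 ^ l := by
  have hper := (isPeriodicPt_sq_iff n x).mpr hx
  have hk := hper.iterate_mod_apply k
  have hl := hper.iterate_mod_apply l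
  rw [h] at hk
  simpa only [pow_iterate] using hk.symm.trans hl

theorem eq_zero_or_one_of_pow_two_pow_eq {F : Type*} [Field F] {n k : ℕ} {x : F}
    (hx : x ^ 2 ^ n = x) (hk : x ^ 2 ^ k = x) (hkn : Nat.gcd k n = 1) : x = 0 ∨ x = 1 := by
  have h := ((isPeriodicPt_sq_iff k x).mpr hk).gcd ((isPeriodicPt_sq_iff n x).mpr hx)
  rw [hkn, isPeriodicPt_sq_iff] at h
  rcases eq_or_ne x 0 with h0 | h0
  · exact Or.inl h0
  · exact Or.inr (mul_left_cancel₀ h0 (by linear_combination h))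

theorem optimal_from_equivalence_conditions
    (i j n : ℕ) (hi : 0 < i) (hij : i < j) (hjn : j < n)
    (F : Type*) [Field F] [Fintype F] [DecidableEq F] [CharP F 2]
    (hcard : Fintype.card F = 2 ^ n)
    (f : F → F) (hf : ∀ x, f x = x ^ (2 ^ j + 2 ^ i + 1))
    (hcond :
      (j ≡ 2 * i [MOD n] ∧ Nat.gcd i n = 1) ∨
      (2 * j ≡ i [MOD n] ∧ Nat.gcd (j - i) n = 1) ∨
      (j + i ≡ 0 [MOD n] ∧ Nat.gcd i n = 1)) :
    ∀ a b : F, a ≠ 0 → b ≠ 0 → a ≠ b → ∀ c : F,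
      (Finset.univ.filter
        (fun x : F => f x + f (x + a) + f (x + b) + f (x + a + b) = c)).card ≤ 4 := by
  intro a b ha hb hab c
  have hper : ∀ x : F, x ^ 2 ^ n = x := fun x => hcard ▸ FiniteField.pow_card x
  have hfix : ∀ k, Nat.gcd k n = 1 →
      ∀ y : F, iterateFrobenius F 2 k y = y → y = 0 ∨ y = 1 := fun k hk y hy =>
    eq_zero_or_one_of_pow_two_pow_eq (hper y) (by rwa [iterateFrobenius_def] at hy) hk
  rcases hcond with ⟨h, hg⟩ | ⟨h, hg⟩ | ⟨h, hg⟩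
  · refine card_secondDeriv_fiber_le_four (iterateFrobenius F 2 i) (RingHom.id F) (hfix i hg)
      f (fun x => ?_) ha hb hab c
    have hx := pow_two_pow_eq_of_modEq (hper x) h
    simp only [hf, iterateFrobenius_def, RingHom.id_apply]
    rw [← pow_mul, ← pow_add, ← two_mul, ← hx]
    ring
  · have hgj : Nat.gcd j n = 1 := by
      have hdi : Nat.gcd j n ∣ i :=
        (h.dvd_iff (Nat.gcd_dvd_right j n)).mp ((Nat.gcd_dvd_left j n).mul_left 2)
      exact Nat.dvd_one.mp (hg ▸ Nat.dvd_gcd (Nat.dvd_sub (Nat.gcd_dvd_left j n) hdi)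
        (Nat.gcd_dvd_right j n))
    refine card_secondDeriv_fiber_le_four (iterateFrobenius F 2 j) (RingHom.id F) (hfix j hgj)
      f (fun x => ?_) ha hb hab c
    have hx := pow_two_pow_eq_of_modEq (hper x) h
    simp only [hf, iterateFrobenius_def, RingHom.id_apply]
    rw [← pow_mul, ← pow_add, ← two_mul, hx]
    ring
  · refine card_secondDeriv_fiber_le_four (iterateFrobenius F 2 i) (iterateFrobenius F 2 i)
      (hfix i hg) f (fun x => ?_) ha hb hab c
    have hx : x ^ 2 ^ (j + i) = x := by
      rw [pow_two_pow_eq_of_modEq (hper x) h, pow_zero, pow_one]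
    simp only [hf, iterateFrobenius_def]
    rw [pow_add, pow_add, mul_pow, mul_pow, ← pow_mul x (2 ^ j), ← pow_add, hx]
    ring
end
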